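/- arXiv:2005.10717 — 4 statements merged into one kernel-verified Lean document; each statement's English description precedes it below -/
import Mathlib

section
/- Let $p, q \ge 2$ be coprime integers. If $x$ is a real number with $0 \le x < \frac{1}{pq}$, then $\overline{\sigma}_{p,q}(x) = 0$; and if $\frac{1}{pq} < x < \frac{1}{2}$, then $\overline{\sigma}_{p,q}(x) > 0$. -/
/-- `C1 p q x` is the number of integer pairs `(i,j)` with `i ≥ 1`, `j ≥ 1`, and
`p*i + q*j < p*q*x`. -/
noncomputable def C1 (p q : ℕ) (x : ℝ) : ℕ :=
  Set.ncard {ij : ℤ × ℤ | 1 ≤ ij.1 ∧ 1 ≤ ij.2 ∧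
    (p : ℝ) * (ij.1 : ℝ) + (q : ℝ) * (ij.2 : ℝ) < (p : ℝ) * (q : ℝ) * x}

/-- `C2 p q x` is the number of integer pairs `(i,j)` with `1 ≤ i ≤ q-1`, `1 ≤ j ≤ p-1`,
and `p*i + q*j > p*q*(1+x)`. -/
noncomputable def C2 (p q : ℕ) (x : ℝ) : ℕ :=
  Set.ncard {ij : ℤ × ℤ | 1 ≤ ij.1 ∧ ij.1 ≤ (q : ℤ) - 1 ∧ 1 ≤ ij.2 ∧ ij.2 ≤ (p : ℤ) - 1 ∧
    (p : ℝ) * (q : ℝ) * (1 + x) < (p : ℝ) * (ij.1 : ℝ) + (q : ℝ) * (ij.2 : ℝ)}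

/-- The negative of the Tristram–Levine signature of the torus knot `T(p,q)` at
`ω = e^{2πix}`, via Litherland's lattice point count. -/
noncomputable def sigmaBar (p q : ℕ) (x : ℝ) : ℤ :=
  ((p : ℤ) - 1) * ((q : ℤ) - 1) - 2 * ((C1 p q x : ℤ) + (C2 p q x : ℤ))

open Finset

/-- The integer points `(i, j)` with `1 ≤ i ≤ q - 1` and `1 ≤ j ≤ p - 1`. -/
noncomputable def latticeBox (p q : ℤ) : Finset (ℤ × ℤ) := Icc 1 (q - 1) ×ˢ Icc 1 (p - 1)

theorem mem_latticeBox {p q : ℤ} {a : ℤ × ℤ} :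
    a ∈ latticeBox p q ↔ (1 ≤ a.1 ∧ a.1 ≤ q - 1) ∧ (1 ≤ a.2 ∧ a.2 ≤ p - 1) := by
  simp [latticeBox]

theorem card_latticeBox {p q : ℤ} (hp : 2 ≤ p) (hq : 2 ≤ q) :
    (#(latticeBox p q) : ℤ) = (p - 1) * (q - 1) := by
  rw [latticeBox, card_product, Int.card_Icc, Int.card_Icc]
  push_cast
  rw [Int.toNat_of_nonneg (by omega), Int.toNat_of_nonneg (by omega)]
  ring

theorem weight_ne_mul_of_mem_latticeBox {p q : ℤ} (h : IsCoprime p q) {a : ℤ × ℤ}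
    (ha : a ∈ latticeBox p q) : p * a.1 + q * a.2 ≠ p * q := by
  intro e
  rw [mem_latticeBox] at ha
  have hd : q ∣ p * a.1 := ⟨p - a.2, by linear_combination e⟩
  have := Int.le_of_dvd (by omega) (h.symm.dvd_of_dvd_mul_left hd)
  omega

/-- The point reflection of the box shows that exactly half of its points lie above the
diagonal. -/
theorem two_mul_card_above_diagonal {p q : ℤ} (hp : 2 ≤ p) (hq : 2 ≤ q) (h : IsCoprime p q) :
    2 * (#{a ∈ latticeBox p q | p * q < p * a.1 + q * a.2} : ℤ) = (p - 1) * (q - 1) := by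
  have hrefl : #{a ∈ latticeBox p q | p * q < p * a.1 + q * a.2} =
      #{a ∈ latticeBox p q | ¬ p * q < p * a.1 + q * a.2} := by
    refine card_bij' (fun a _ => (q - a.1, p - a.2)) (fun a _ => (q - a.1, p - a.2)) ?_ ?_ ?_ ?_
    · intro a ha
      rw [mem_filter, mem_latticeBox] at ha ⊢
      exact ⟨by dsimp only; omega, by dsimp only; linarith⟩
    · intro a ha
      rw [mem_filter] at ha
      have hne := weight_ne_mul_of_mem_latticeBox h ha.1
      have hlt := lt_of_le_of_ne (not_lt.mp ha.2) hne
      rw [mem_latticeBox] at ha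
      rw [mem_filter, mem_latticeBox]
      exact ⟨by dsimp only; omega, by dsimp only; linarith⟩
    · intro a _; simp
    · intro a _; simp
  have hsum := card_filter_add_card_filter_not (s := latticeBox p q)
    (fun a => p * q < p * a.1 + q * a.2)
  rw [← card_latticeBox hp hq, ← hsum, ← hrefl]
  push_cast
  ring

theorem exists_mul_sub_mul_eq_one {p q : ℤ} (hp : 2 ≤ p) (hq : 2 ≤ q) (h : IsCoprime p q) :
    ∃ i k : ℤ, 1 ≤ i ∧ i ≤ q - 1 ∧ 1 ≤ k ∧ k ≤ p - 1 ∧ q * k = p * i + 1 := by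
  obtain ⟨u, v, huv⟩ := h
  have hmod := Int.mul_ediv_add_emod (-u) q
  have hnonneg := Int.emod_nonneg (-u) (show q ≠ 0 by omega)
  have hlt := Int.emod_lt_of_pos (-u) (show 0 < q by omega)
  set i := (-u) % q
  set w := (-u) / q
  have hk : q * (v - p * w) = p * i + 1 := by linear_combination huv - p * hmod
  have hi : i ≠ 0 := by
    intro h0
    rw [h0] at hk
    have := Int.le_of_dvd one_pos (⟨v - p * w, by linarith⟩ : q ∣ 1)
    omega
  refine ⟨i, v - p * w, by omega, by omega, ?_, ?_, hk⟩
  · have : 0 < p * i := by apply mul_pos <;> omega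
    have : 0 < v - p * w := pos_of_mul_pos_right (a := q) (by omega) (by omega)
    omega
  · have : v - p * w < p := by
      refine lt_of_mul_lt_mul_left (a := q) ?_ (by omega)
      nlinarith
    omega

/-- Compare columns: column `i` of the triangle is shifted into column `q - i` of the strip,
and a column with `p * i ≡ -1` modulo `q` leaves a point of the strip uncovered. -/
theorem card_triangle_lt_card_strip {p q m : ℤ} (hp : 2 ≤ p) (hq : 2 ≤ q) (h : IsCoprime p q)
    (hm : 1 ≤ m) (hm' : 2 * m < p * q) :
    #{a ∈ latticeBox p q | p * a.1 + q * a.2 ≤ m} <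
      #{a ∈ latticeBox p q | p * q < p * a.1 + q * a.2 ∧ p * a.1 + q * a.2 ≤ p * q + m} := by
  set f : ℤ × ℤ → ℤ × ℤ := fun a => (q - a.1, a.2 + p * a.1 / q) with hf
  have hinj : Function.Injective f := by
    intro a b hab
    simp only [hf, Prod.mk.injEq] at hab
    have h1 : a.1 = b.1 := by omega
    rw [h1] at hab
    exact Prod.ext h1 (by omega)
  rw [← card_image_of_injective _ hinj]
  refine card_lt_card (ssubset_iff_of_subset ?_ |>.mpr ?_)
  · intro b hb
    obtain ⟨a, ha, rfl⟩ := mem_image.mp hb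
    rw [mem_filter, mem_latticeBox] at ha
    obtain ⟨⟨⟨h1, h2⟩, h3, h4⟩, h5⟩ := ha
    have hmod := Int.mul_ediv_add_emod (p * a.1) q
    have hnonneg := Int.emod_nonneg (p * a.1) (show q ≠ 0 by omega)
    have hlt := Int.emod_lt_of_pos (p * a.1) (show 0 < q by omega)
    have hdiv : 0 ≤ p * a.1 / q := Int.ediv_nonneg (by nlinarith) (by omega)
    have hpos : 0 < p * a.1 := by nlinarith
    rw [mem_filter, mem_latticeBox]
    simp only [hf]
    generalize p * a.1 / q = d at *
    refine ⟨⟨by omega, by omega, ?_⟩, by nlinarith, by nlinarith⟩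
    have : a.2 + d < p := by
      refine lt_of_mul_lt_mul_left (a := q) ?_ (by omega)
      nlinarith
    omega
  · obtain ⟨i, k, hi, hi', hk, hk', hik⟩ := exists_mul_sub_mul_eq_one hp hq h
    by_cases hcol : m ≤ p * i
    · refine ⟨(q - i, k), ?_, ?_⟩
      · rw [mem_filter, mem_latticeBox]
        exact ⟨by dsimp only; omega, by dsimp only; linarith, by dsimp only; linarith⟩
      · intro hmem
        obtain ⟨a, ha, hfa⟩ := mem_image.mp hmem
        rw [mem_filter, mem_latticeBox] at ha
        simp only [hf, Prod.mk.injEq] at hfa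
        have h1 : a.1 = i := by omega
        rw [h1] at ha
        nlinarith
    · have hmod := Int.mul_ediv_add_emod (m - 1) q
      have hnonneg := Int.emod_nonneg (m - 1) (show q ≠ 0 by omega)
      have hlt := Int.emod_lt_of_pos (m - 1) (show 0 < q by omega)
      have hdiv : 0 ≤ (m - 1) / q := Int.ediv_nonneg (by omega) (by omega)
      generalize (m - 1) / q = d at *
      refine ⟨(q - i, k + d), ?_, ?_⟩
      · rw [mem_filter, mem_latticeBox]
        refine ⟨⟨by dsimp only; omega, by dsimp only; omega, ?_⟩,
          by dsimp only; nlinarith, by dsimp only; nlinarith⟩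
        have : k + d < p := by
          refine lt_of_mul_lt_mul_left (a := q) ?_ (by omega)
          nlinarith
        dsimp only
        omega
      · intro hmem
        obtain ⟨a, ha, hfa⟩ := mem_image.mp hmem
        rw [mem_filter, mem_latticeBox] at ha
        simp only [hf, Prod.mk.injEq] at hfa
        have h1 : a.1 = i := by omega
        have hfloor : p * i / q = k - 1 := by
          rw [Int.ediv_eq_iff_of_pos (by omega)]
          constructor <;> nlinarith
        rw [h1, hfloor] at hfa
        have h2 : a.2 = d + 1 := by omega
        rw [h1, h2] at ha
        nlinarith

theorem C1_le_card_triangle {p q : ℕ} {x : ℝ} (hp : 2 ≤ p) (hq : 2 ≤ q) (hx : x < 1) :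
    C1 p q x ≤ #{a ∈ latticeBox p q | (p : ℤ) * a.1 + q * a.2 ≤ ⌊(p : ℝ) * q * x⌋} := by
  rw [C1, ← Set.ncard_coe_finset]
  refine Set.ncard_le_ncard ?_ (finite_toSet _)
  rintro ⟨i, j⟩ ⟨hi, hj, hij⟩
  dsimp only at hi hj hij
  have hpq : (0 : ℝ) < p * q := by positivity
  have hlt : (p : ℤ) * i + q * j < p * q := by
    have : (p : ℝ) * i + q * j < p * q := by nlinarith
    exact_mod_cast this
  rw [mem_coe, mem_filter, mem_latticeBox, Int.le_floor]
  refine ⟨⟨⟨hi, ?_⟩, hj, ?_⟩, by push_cast; exact hij.le⟩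
  · have : i < q := lt_of_mul_lt_mul_left (a := (p : ℤ)) (by nlinarith) (by omega)
    dsimp only
    omega
  · have : j < p := lt_of_mul_lt_mul_left (a := (q : ℤ)) (by nlinarith) (by omega)
    dsimp only
    omega

theorem C2_eq_card (p q : ℕ) (x : ℝ) :
    C2 p q x =
      #{a ∈ latticeBox p q | (p : ℤ) * q + ⌊(p : ℝ) * q * x⌋ < p * a.1 + q * a.2} := by
  rw [C2, ← Set.ncard_coe_finset]
  congr 1
  ext ⟨i, j⟩
  have hfloor : (p : ℤ) * q + ⌊(p : ℝ) * q * x⌋ < p * i + q * j ↔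
      (p : ℝ) * q * (1 + x) < p * i + q * j := by
    rw [← lt_sub_iff_add_lt', Int.floor_lt]
    push_cast
    rw [lt_sub_iff_add_lt', mul_add, mul_one]
  rw [mem_coe, mem_filter, mem_latticeBox, hfloor]
  simp only [Set.mem_ofPred_eq, and_assoc]

theorem sigmaBar_eq_two_mul_card_strip_sub {p q : ℕ} {x : ℝ} (hp : 2 ≤ p) (hq : 2 ≤ q)
    (hpq : Nat.Coprime p q) (hx : 0 ≤ x) :
    sigmaBar p q x = 2 * (#{a ∈ latticeBox p q | (p : ℤ) * q < p * a.1 + q * a.2 ∧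
      (p : ℤ) * a.1 + q * a.2 ≤ p * q + ⌊(p : ℝ) * q * x⌋} : ℤ) - 2 * C1 p q x := by
  have hm : 0 ≤ ⌊(p : ℝ) * q * x⌋ := Int.floor_nonneg.mpr (by positivity)
  have hhalf := two_mul_card_above_diagonal (p := p) (q := q) (by omega) (by omega)
    (Nat.isCoprime_iff_coprime.mpr hpq)
  have hsplit := card_filter_add_card_filter_not
    (s := {a ∈ latticeBox p q | (p : ℤ) * q < p * a.1 + q * a.2})
    (fun a => (p : ℤ) * a.1 + q * a.2 ≤ p * q + ⌊(p : ℝ) * q * x⌋)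
  rw [filter_filter, filter_filter] at hsplit
  have hC2 : C2 p q x = #{a ∈ latticeBox p q | (p : ℤ) * q < p * a.1 + q * a.2 ∧
      ¬ (p : ℤ) * a.1 + q * a.2 ≤ p * q + ⌊(p : ℝ) * q * x⌋} := by
    rw [C2_eq_card]
    congr 1
    refine filter_congr fun a _ => ?_
    constructor
    · intro h
      exact ⟨by linarith, not_le.mpr h⟩
    · intro h
      exact not_le.mp h.2
  rw [sigmaBar, ← hhalf, ← hsplit, ← hC2]
  push_cast
  ring

theorem sigmaBar_eq_zero_of_small_and_pos_of_large
    (p q : ℕ) (hp : 2 ≤ p) (hq : 2 ≤ q) (hpq : Nat.Coprime p q) (x : ℝ) :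
    (0 ≤ x ∧ x < 1 / ((p : ℝ) * q) → sigmaBar p q x = 0) ∧
    (1 / ((p : ℝ) * q) < x ∧ x < 1 / 2 → 0 < sigmaBar p q x) := by
  have hpos : (0 : ℝ) < p * q := by positivity
  constructor
  · rintro ⟨hx0, hx⟩
    have hM : (p : ℝ) * q * x < 1 := by rwa [lt_div_iff₀' hpos] at hx
    have hx1 : x < 1 := hx.trans_le <| by
      rw [div_le_one hpos]
      exact_mod_cast Nat.mul_pos (by omega : 0 < p) (by omega : 0 < q)
    have hfloor : ⌊(p : ℝ) * q * x⌋ = 0 := Int.floor_eq_zero_iff.mpr ⟨by positivity, hM⟩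
    have hC1 := C1_le_card_triangle hp hq hx1
    rw [sigmaBar_eq_two_mul_card_strip_sub hp hq hpq hx0]
    rw [hfloor] at hC1 ⊢
    rw [filter_false_of_mem, card_empty, Nat.le_zero] at hC1
    · rw [hC1, filter_false_of_mem]
      · simp
      · intro a _ ha
        linarith
    · intro a ha
      rw [mem_latticeBox] at ha
      have : (0 : ℤ) < p * a.1 := mul_pos (by omega) (by omega)
      have : (0 : ℤ) < q * a.2 := mul_pos (by omega) (by omega)
      omega
  · rintro ⟨hx, hx'⟩
    have hx0 : 0 ≤ x := le_trans (by positivity) hx.le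
    have hM : 1 < (p : ℝ) * q * x := by rwa [div_lt_iff₀' hpos] at hx
    have hm : 1 ≤ ⌊(p : ℝ) * q * x⌋ := Int.le_floor.mpr (by exact_mod_cast hM.le)
    have hm' : 2 * ⌊(p : ℝ) * q * x⌋ < (p : ℤ) * q := by
      have : 2 * (⌊(p : ℝ) * q * x⌋ : ℝ) < p * q := by
        nlinarith [Int.floor_le ((p : ℝ) * q * x)]
      exact_mod_cast this
    have hC1 := C1_le_card_triangle hp hq (hx'.trans (by norm_num))
    have hlt := card_triangle_lt_card_strip (p := p) (q := q) (by omega) (by omega)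
      (Nat.isCoprime_iff_coprime.mpr hpq) hm hm'
    rw [sigmaBar_eq_two_mul_card_strip_sub hp hq hpq hx0]
    have := hC1.trans_lt hlt
    omega
end

section
/- Let $p, q \ge 2$ be coprime integers and let $x$ be a real number with $0 < x < 1$. Then $\overline{\sigma}_{p,q}(x) > (p-1)(q-1) - pqx^2 - pq(1-x)^2$. -/
/-- The lattice points counted by `C1` number strictly fewer than the area of the triangle
with legs `q * x` and `p * x`. -/
theorem C1_lt_area (p q : ℕ) (hp : 0 < p) (hq : 0 < q) {x : ℝ} (hx : 0 < x) :
    (C1 p q x : ℝ) < (p : ℝ) * q * x ^ 2 / 2 := by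
  have hp' : (0 : ℝ) < p := by exact_mod_cast hp
  have hq' : (0 : ℝ) < q := by exact_mod_cast hq
  set m : ℕ := ⌊(q : ℝ) * x⌋₊ with hm
  let h : ℕ → ℝ := fun i => p * (x - ((i : ℝ) + 1) / q)
  let F : Finset (ℤ × ℤ) := (Finset.range m).biUnion fun i =>
    (Finset.Icc 1 ⌊h i⌋₊).image fun j : ℕ => ((i : ℤ) + 1, (j : ℤ))
  have hmle : (m : ℝ) ≤ q * x := Nat.floor_le (by positivity)
  have hcard : C1 p q x ≤ F.card := by
    rw [C1, ← Set.ncard_coe_finset F]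
    refine Set.ncard_le_ncard ?_ F.finite_toSet
    rintro ⟨i, j⟩ ⟨hi, hj, hij⟩
    dsimp only at hi hj hij
    obtain ⟨a, rfl⟩ : ∃ a : ℕ, i = a + 1 := ⟨(i - 1).toNat, by omega⟩
    lift j to ℕ using by omega
    push_cast at hij
    have hj' : (1 : ℝ) ≤ j := by exact_mod_cast hj
    simp only [F, Finset.coe_biUnion, Set.mem_iUnion, Finset.coe_image, Set.mem_image,
      Finset.mem_coe, Finset.mem_range, Finset.mem_Icc, exists_prop]
    refine ⟨a, ?_, j, ⟨by omega, Nat.le_floor ?_⟩, rfl⟩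
    · refine Nat.lt_of_succ_le (Nat.le_floor ?_)
      push_cast
      have : (p : ℝ) * (a + 1) < p * (q * x) := by nlinarith
      exact (lt_of_mul_lt_mul_left this hp'.le).le
    · have e : h a = (p * q * x - p * (a + 1)) / q := by
        simp only [h]
        field_simp
      rw [e, le_div_iff₀ hq']
      linarith
  have hF : (F.card : ℝ) ≤ ∑ i ∈ Finset.range m, h i := by
    calc (F.card : ℝ) ≤ ((∑ i ∈ Finset.range m, ⌊h i⌋₊ : ℕ) : ℝ) := by
          refine Nat.cast_le.2 (Finset.card_biUnion_le.trans (Finset.sum_le_sum fun i _ => ?_))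
          exact Finset.card_image_le.trans (by simp)
      _ ≤ ∑ i ∈ Finset.range m, h i := by
          rw [Nat.cast_sum]
          refine Finset.sum_le_sum fun i hi => Nat.floor_le ?_
          have him : (i : ℝ) + 1 ≤ m := by exact_mod_cast Finset.mem_range.1 hi
          refine mul_nonneg hp'.le (sub_nonneg.2 ((div_le_iff₀ hq').2 ?_))
          linarith
  have hsum : ∀ n : ℕ,
      ∑ i ∈ Finset.range n, h i = p / (2 * q) * (2 * n * (q * x) - n * (n + 1)) := by
    intro n
    induction n with
    | zero => simp
    | succ n ih =>
      rw [Finset.sum_range_succ, ih]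
      simp only [h]
      push_cast
      field_simp
      ring
  have hpos : 0 < (q * x - m) ^ 2 + (m : ℝ) := by
    rcases Nat.eq_zero_or_pos m with h0 | h0
    · rw [h0]
      simp only [Nat.cast_zero, sub_zero, add_zero]
      positivity
    · have : (0 : ℝ) < m := by exact_mod_cast h0
      positivity
  have harea : (p : ℝ) * q * x ^ 2 / 2 - p / (2 * q) * (2 * m * (q * x) - m * (m + 1))
      = p / (2 * q) * ((q * x - m) ^ 2 + m) := by
    field_simp
    ring
  have : 0 < (p : ℝ) / (2 * q) * ((q * x - m) ^ 2 + m) := by positivity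
  have hc : (C1 p q x : ℝ) ≤ F.card := by exact_mod_cast hcard
  linarith [hsum m]

/-- The central symmetry `(i, j) ↦ (q - i, p - j)` turns the `C2` count into a `C1` count. -/
theorem C2_eq_C1_one_sub (p q : ℕ) (hp : 0 < p) (hq : 0 < q) {x : ℝ} (hx : 0 ≤ x) :
    C2 p q x = C1 p q (1 - x) := by
  have hp' : (0 : ℝ) < p := by exact_mod_cast hp
  have hq' : (0 : ℝ) < q := by exact_mod_cast hq
  refine Set.ncard_congr (fun ij _ => ((q : ℤ) - ij.1, (p : ℤ) - ij.2)) ?_ ?_ ?_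
  · rintro ⟨i, j⟩ ⟨hi, hi', hj, hj', hij⟩
    refine ⟨by dsimp only at *; omega, by dsimp only at *; omega, ?_⟩
    push_cast
    linarith
  · rintro ⟨i, j⟩ ⟨k, l⟩ _ _ hkl
    simpa using hkl
  · rintro ⟨i, j⟩ ⟨hi, hj, hij⟩
    dsimp only at hi hj hij
    have hi1 : (1 : ℝ) ≤ i := by exact_mod_cast hi
    have hj1 : (1 : ℝ) ≤ j := by exact_mod_cast hj
    have hx' : 0 ≤ (p : ℝ) * q * x := by positivity
    have hiq : i < q := by
      have : (p : ℝ) * i < p * q := by nlinarith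
      exact_mod_cast lt_of_mul_lt_mul_left this hp'.le
    have hjp : j < p := by
      have : (q : ℝ) * j < q * p := by nlinarith
      exact_mod_cast lt_of_mul_lt_mul_left this hq'.le
    refine ⟨((q : ℤ) - i, (p : ℤ) - j), ⟨?_, ?_, ?_, ?_, ?_⟩, by simp⟩
    · dsimp only; omega
    · dsimp only; omega
    · dsimp only; omega
    · dsimp only; omega
    · push_cast
      linarith

theorem sigmaBar_lower_bound
    (p q : ℕ) (hp : 2 ≤ p) (hq : 2 ≤ q) (hpq : Nat.Coprime p q)
    (x : ℝ) (hx0 : 0 < x) (hx1 : x < 1) :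
    ((p : ℝ) - 1) * ((q : ℝ) - 1) - (p : ℝ) * q * x ^ 2 - (p : ℝ) * q * (1 - x) ^ 2
      < (sigmaBar p q x : ℝ) := by
  have h1 := C1_lt_area p q (by omega) (by omega) hx0
  have h2 := C1_lt_area p q (by omega) (by omega) (sub_pos.2 hx1)
  rw [← C2_eq_C1_one_sub p q (by omega) (by omega) hx0.le] at h2
  rw [sigmaBar]
  push_cast
  linarith
end

section
/- Let $l_1, l_2 \ge 2$ be integers whose greatest common divisor $n = \gcd(l_1, l_2)$ satisfies $n \ge 2$, and let $s_1, s_2 \in \{1, -1\}$. Suppose there exist $\epsilon_1, \epsilon_2 \in \{1, -1\}$ such that, as rational numbers, $s_1\left(1 - \frac{2 l_1^2 (n-1)}{n^2}\right) + \epsilon_1 = s_2\left(1 - \frac{2 l_2^2 (n-1)}{n^2}\right) + \epsilon_2$. Then either $l_1 = l_2 = 2$ and $s_1 \ne s_2$, or $l_1 = l_2$ and $s_1 = s_2$. -/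
/-- The squares of two positive integers never differ by exactly one. -/
theorem sq_ne_sq_add_one {a b : ℤ} (ha : 1 ≤ a) (hb : 1 ≤ b) : a ^ 2 ≠ b ^ 2 + 1 := by
  intro h
  have hlt : b < a := by nlinarith
  nlinarith

/-- Positive integers `a`, `b` are equal if a positive multiple of `a ^ 2 - b ^ 2` has absolute
value at most one. -/
theorem eq_of_abs_mul_sq_sub_sq_le_one {a b m : ℤ} (ha : 1 ≤ a) (hb : 1 ≤ b) (hm : 1 ≤ m)
    (h : |m * (a ^ 2 - b ^ 2)| ≤ 1) : a = b := by
  have hle : |a ^ 2 - b ^ 2| ≤ 1 := by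
    rw [abs_mul, abs_of_pos (by linarith)] at h
    nlinarith [abs_nonneg (a ^ 2 - b ^ 2)]
  have hab := sq_ne_sq_add_one ha hb
  have hba := sq_ne_sq_add_one hb ha
  rw [abs_le] at hle
  have hsq : a ^ 2 = b ^ 2 := by omega
  nlinarith

/-- If `m * (a ^ 2 + b ^ 2) ≤ 2` for positive integers, then all of them are equal to one. -/
theorem eq_one_of_mul_sq_add_sq_le_two {a b m : ℤ} (ha : 1 ≤ a) (hb : 1 ≤ b) (hm : 1 ≤ m)
    (h : m * (a ^ 2 + b ^ 2) ≤ 2) : a = 1 ∧ b = 1 ∧ m = 1 := by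
  have ha2 : a ≤ a ^ 2 := by nlinarith
  have hb2 : b ≤ b ^ 2 := by nlinarith
  have hs : a ^ 2 + b ^ 2 ≤ 2 := by nlinarith
  refine ⟨by linarith, by linarith, ?_⟩
  nlinarith

theorem gcd_obstruction (l1 l2 : ℤ) (h1 : 2 ≤ l1) (h2 : 2 ≤ l2)
    (n : ℤ) (hn : n = Int.gcd l1 l2) (hn2 : 2 ≤ n)
    (s1 s2 : ℤ) (hs1 : s1 = 1 ∨ s1 = -1) (hs2 : s2 = 1 ∨ s2 = -1)
    (h : ∃ ε1 ε2 : ℚ, (ε1 = 1 ∨ ε1 = -1) ∧ (ε2 = 1 ∨ ε2 = -1) ∧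
      (s1 : ℚ) * (1 - 2 * (l1 : ℚ) ^ 2 * ((n : ℚ) - 1) / (n : ℚ) ^ 2) + ε1
        = (s2 : ℚ) * (1 - 2 * (l2 : ℚ) ^ 2 * ((n : ℚ) - 1) / (n : ℚ) ^ 2) + ε2) :
    (l1 = 2 ∧ l2 = 2 ∧ s1 ≠ s2) ∨ (l1 = l2 ∧ s1 = s2) := by
  obtain ⟨ε1, ε2, hε1, hε2, h⟩ := h
  obtain ⟨a, rfl⟩ : n ∣ l1 := hn ▸ Int.gcd_dvd_left l1 l2
  obtain ⟨b, rfl⟩ : n ∣ l2 := hn ▸ Int.gcd_dvd_right (n * a) l2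
  clear hn
  have ha : 1 ≤ a := by nlinarith
  have hb : 1 ≤ b := by nlinarith
  have hm : 1 ≤ n - 1 := by linarith
  have hn0 : (n : ℚ) ≠ 0 := by
    have : n ≠ 0 := by linarith
    exact_mod_cast this
  have cancel : ∀ x : ℤ, 2 * ((n * x : ℤ) : ℚ) ^ 2 * ((n : ℚ) - 1) / (n : ℚ) ^ 2
      = 2 * ((n : ℚ) - 1) * (x : ℚ) ^ 2 := by
    intro x
    push_cast
    field_simp
  rw [cancel, cancel] at h
  have hε : |ε1 - ε2| ≤ 2 := by
    rcases hε1 with rfl | rfl <;> rcases hε2 with rfl | rfl <;> norm_num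
  rw [abs_le] at hε
  have same (hd : |((n : ℚ) - 1) * ((a : ℚ) ^ 2 - (b : ℚ) ^ 2)| ≤ 1) : n * a = n * b := by
    rw [eq_of_abs_mul_sq_sub_sq_le_one ha hb hm (by exact_mod_cast hd)]
  have opposite (hd : ((n : ℚ) - 1) * ((a : ℚ) ^ 2 + (b : ℚ) ^ 2) ≤ 2) :
      n * a = 2 ∧ n * b = 2 := by
    obtain ⟨rfl, rfl, hn1⟩ := eq_one_of_mul_sq_add_sq_le_two ha hb hm (by exact_mod_cast hd)
    constructor <;> linarith
  rcases hs1 with rfl | rfl <;> rcases hs2 with rfl | rfl <;> push_cast at h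
  · exact Or.inr ⟨same (abs_le.2 ⟨by linarith, by linarith⟩), rfl⟩
  · obtain ⟨h1, h2⟩ := opposite (by linarith)
    exact Or.inl ⟨h1, h2, by norm_num⟩
  · obtain ⟨h1, h2⟩ := opposite (by linarith)
    exact Or.inl ⟨h1, h2, by norm_num⟩
  · exact Or.inr ⟨same (abs_le.2 ⟨by linarith, by linarith⟩), rfl⟩
end

section
/- Let $l \ge 6$ be an integer. Then there is no integer $k \ge 1$ with the following property: if $l$ is odd, writing $l = 2\alpha + 1$, then $v^{(k)}_{jl} = \frac{(\alpha - j)(\alpha - j + 1)}{2}$ for all integers $0 \le j \le \alpha$; if $l$ is even, writing $l = 2\beta + 2$, then $v^{(k)}_{(2j+1)(\beta+1)} = \frac{(\beta - j)(\beta - j + 1)}{2}$ for all integers $0 \le j \le \beta$. -/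
/-- The sequence of Heegaard Floer invariants `V_i(T(2, 2k+1))`, which equals
`V_i(K)` for any alternating knot `K` with signature `-2k`. -/
def v (k : ℕ) (i : ℕ) : ℕ :=
  if i < k then
    if Even k then k / 2 - i / 2
    else (k + 1) / 2 - (i + 1) / 2
  else 0

theorem no_alternating_knot_unknotted_with_large_linking (l : ℕ) (hl : 6 ≤ l) :
    ¬ ∃ k : ℕ, 1 ≤ k ∧
      (∀ α : ℕ, l = 2 * α + 1 →
        ∀ j : ℕ, j ≤ α → v k (j * l) = (α - j) * (α - j + 1) / 2) ∧
      (∀ β : ℕ, l = 2 * β + 2 →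
        ∀ j : ℕ, j ≤ β → v k ((2 * j + 1) * (β + 1)) = (β - j) * (β - j + 1) / 2) := by
  rintro ⟨k, -, hodd, heven⟩
  rcases Nat.even_or_odd' l with ⟨c, hc | hc⟩
  · obtain ⟨b, rfl⟩ : ∃ b, c = b + 3 := ⟨c - 3, by omega⟩
    have h₀ := heven (b + 2) (by omega) 0 (by omega)
    have h₁ := heven (b + 2) (by omega) 1 (by omega)
    rw [show b + 2 - 0 = b + 2 by omega,
      show (b + 2) * (b + 2 + 1) = b * b + 5 * b + 6 by ring] at h₀
    rw [show b + 2 - 1 = b + 1 by omega,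
      show (b + 1) * (b + 1 + 1) = b * b + 3 * b + 2 by ring] at h₁
    simp only [v, Nat.even_iff] at h₀ h₁
    split_ifs at h₀ h₁ <;> omega
  · obtain ⟨a, rfl⟩ : ∃ a, c = a + 3 := ⟨c - 3, by omega⟩
    subst hc
    have h₀ := hodd (a + 3) rfl 0 (by omega)
    have h₁ := hodd (a + 3) rfl 1 (by omega)
    have h₂ := hodd (a + 3) rfl 2 (by omega)
    rw [show a + 3 - 0 = a + 3 by omega,
      show (a + 3) * (a + 3 + 1) = a * a + 7 * a + 12 by ring] at h₀
    rw [show a + 3 - 1 = a + 2 by omega,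
      show (a + 2) * (a + 2 + 1) = a * a + 5 * a + 6 by ring] at h₁
    rw [show a + 3 - 2 = a + 1 by omega,
      show (a + 1) * (a + 1 + 1) = a * a + 3 * a + 2 by ring] at h₂
    simp only [v, Nat.even_iff] at h₀ h₁ h₂
    split_ifs at h₀ h₁ h₂ <;> omega
end
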